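/- Near-oracle cumulative task quality (Corollary 1, deterministic core). Under the hypotheses of the LinUCB regret theorem — λ ≥ 1; for each round t = 1, …, T a finite nonempty candidate set C_t with contexts x_{j,t} ∈ ℝ^d, ‖x_{j,t}‖₂ ≤ 1, expected rewards μ_{j,t} = x_{j,t}ᵀθ*; design matrices A_0 = λ I_d, A_t = A_{t−1} + x_{a_t,t} x_{a_t,t}ᵀ; selection a_t ∈ argmax_{j∈C_t} [x_{j,t}ᵀθ̂_{t−1} + β_{t−1}·√(x_{j,t}ᵀ A_{t−1}⁻¹ x_{j,t})]; an optimal arm j_t* ∈ C_t for every t; nondecreasing nonnegative β_0 ≤ … ≤ β_T; and the confidence-ellipsoid condition ‖θ̂_{t−1} − θ*‖_{A_{t−1}} ≤ β_{t−1} for all t — the algorithm's cumulative expected reward ALG(T) = Σ_{t=1}^{T} μ_{a_t,t} and the oracle value OPT(T) = Σ_{t=1}^{T} μ_{j_t*,t} satisfy ALG(T) ≥ OPT(T) − 2·β_T·√( 2·T·d·log(1 + T/λ) ). -/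

import Mathlib

open Matrix Finset

namespace Matrix

variable {n : Type*} [Fintype n]

theorem dotProduct_mulVec_comm_of_isHermitian {A : Matrix n n ℝ} (hA : A.IsHermitian)
    (u v : n → ℝ) : u ⬝ᵥ A *ᵥ v = v ⬝ᵥ A *ᵥ u := by
  have hT : Aᵀ = A := by simpa [IsHermitian, conjTranspose_eq_transpose_of_trivial] using hA
  rw [dotProduct_mulVec, ← mulVec_transpose, hT, dotProduct_comm]

/-- Cauchy–Schwarz inequality for the bilinear form of a positive definite matrix. -/
theorem PosDef.sq_dotProduct_mulVec_le {A : Matrix n n ℝ} (hA : A.PosDef) (u v : n → ℝ) :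
    (u ⬝ᵥ A *ᵥ v) ^ 2 ≤ (u ⬝ᵥ A *ᵥ u) * (v ⬝ᵥ A *ᵥ v) := by
  have h : discrim (v ⬝ᵥ A *ᵥ v) (2 * (u ⬝ᵥ A *ᵥ v)) (u ⬝ᵥ A *ᵥ u) ≤ 0 := by
    refine discrim_le_zero fun s => ?_
    have h0 := hA.posSemidef.dotProduct_mulVec_nonneg (u + s • v)
    have hs := dotProduct_mulVec_comm_of_isHermitian hA.isHermitian u v
    simp only [star_trivial, mulVec_add, mulVec_smul, dotProduct_add, add_dotProduct,
      dotProduct_smul, smul_dotProduct, smul_eq_mul] at h0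
    rw [← hs] at h0
    linarith
  unfold discrim at h
  linarith

theorem PosDef.mulVec_inv_mulVec [DecidableEq n] {A : Matrix n n ℝ} (hA : A.PosDef) (u : n → ℝ) :
    A *ᵥ A⁻¹ *ᵥ u = u := by
  rw [mulVec_mulVec, mul_nonsing_inv _ hA.det_pos.ne'.isUnit, one_mulVec]

/-- Cauchy–Schwarz inequality for the dual norms given by `A⁻¹` and `A`. -/
theorem PosDef.abs_dotProduct_le [DecidableEq n] {A : Matrix n n ℝ} (hA : A.PosDef) (u v : n → ℝ) :
    |u ⬝ᵥ v| ≤ √(u ⬝ᵥ A⁻¹ *ᵥ u) * √(v ⬝ᵥ A *ᵥ v) := by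
  have h := hA.sq_dotProduct_mulVec_le v (A⁻¹ *ᵥ u)
  rw [hA.mulVec_inv_mulVec, dotProduct_comm v u, dotProduct_comm _ u, mul_comm] at h
  have hu : 0 ≤ u ⬝ᵥ A⁻¹ *ᵥ u := by
    simpa using hA.inv.posSemidef.dotProduct_mulVec_nonneg u
  rw [← Real.sqrt_mul hu]
  exact Real.abs_le_sqrt h

theorem PosDef.dotProduct_inv_mulVec_le_one [DecidableEq n] {A : Matrix n n ℝ} (hA : A.PosDef)
    (hlow : ∀ v, v ⬝ᵥ v ≤ v ⬝ᵥ A *ᵥ v) {u : n → ℝ} (hu : u ⬝ᵥ u ≤ 1) :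
    u ⬝ᵥ A⁻¹ *ᵥ u ≤ 1 := by
  have h1 := hlow (A⁻¹ *ᵥ u)
  rw [hA.mulVec_inv_mulVec, dotProduct_comm _ u] at h1
  have h2 : 0 ≤ (u - A⁻¹ *ᵥ u) ⬝ᵥ (u - A⁻¹ *ᵥ u) := by
    simpa using dotProduct_star_self_nonneg (u - A⁻¹ *ᵥ u)
  rw [sub_dotProduct, dotProduct_sub, dotProduct_sub, dotProduct_comm (A⁻¹ *ᵥ u) u] at h2
  linarith

theorem PosDef.det_le_pow [DecidableEq n] {A : Matrix n n ℝ} (hA : A.PosDef) {c : ℝ}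
    (hup : ∀ v, v ⬝ᵥ A *ᵥ v ≤ c * (v ⬝ᵥ v)) : A.det ≤ c ^ Fintype.card n := by
  rw [hA.isHermitian.det_eq_prod_eigenvalues]
  calc ∏ i, (hA.isHermitian.eigenvalues i : ℝ) ≤ ∏ _i : n, c := by
        refine Finset.prod_le_prod (fun i _ => (hA.eigenvalues_pos i).le) fun i _ => ?_
        rw [hA.isHermitian.eigenvalues_eq]
        have h1 := EuclideanSpace.inner_eq_star_dotProduct (𝕜 := ℝ)
          (hA.isHermitian.eigenvectorBasis i) (hA.isHermitian.eigenvectorBasis i)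
        rw [real_inner_self_eq_norm_sq, hA.isHermitian.eigenvectorBasis.orthonormal.1 i] at h1
        have h2 := hup (hA.isHermitian.eigenvectorBasis i)
        simp only [star_trivial] at h1 ⊢
        rw [← h1] at h2
        simpa using h2
    _ = c ^ Fintype.card n := by simp

theorem PosDef.det_add_vecMulVec [DecidableEq n] {A : Matrix n n ℝ} (hA : A.PosDef) (u : n → ℝ) :
    (A + vecMulVec u u).det = A.det * (1 + u ⬝ᵥ A⁻¹ *ᵥ u) := by
  have h := det_add_replicateCol_mul_replicateRow (ι := Unit) hA.det_pos.ne'.isUnit u u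
  rw [← vecMulVec_eq] at h
  rw [h, Matrix.mul_assoc, ← replicateCol_mulVec, replicateRow_mul_replicateCol]
  simp

theorem dotProduct_vecMulVec_self_mulVec (u v : n → ℝ) :
    v ⬝ᵥ vecMulVec u u *ᵥ v = (u ⬝ᵥ v) ^ 2 := by
  rw [vecMulVec_mulVec]
  simp [dotProduct_comm v u, sq]

theorem PosDef.add_vecMulVec_self {A : Matrix n n ℝ} (hA : A.PosDef) (u : n → ℝ) :
    (A + vecMulVec u u).PosDef := by
  simpa using hA.add_posSemidef (posSemidef_vecMulVec_self_star u)

theorem sq_dotProduct_le (u v : n → ℝ) : (u ⬝ᵥ v) ^ 2 ≤ (u ⬝ᵥ u) * (v ⬝ᵥ v) := by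
  simpa [dotProduct, ← sq] using Finset.sum_mul_sq_le_sq_mul_sq Finset.univ u v

end Matrix

theorem Real.le_two_mul_log_one_add {s : ℝ} (h0 : 0 ≤ s) (h1 : s ≤ 1) :
    s ≤ 2 * Real.log (1 + s) := by
  have h := Real.le_log_one_add_of_nonneg h0
  have h2 : s / 2 ≤ 2 * s / (s + 2) := by
    rw [div_le_div_iff₀ (by norm_num) (by linarith)]
    nlinarith
  linarith

/-- Design matrices built from vectors in the unit ball stay between `lam` and `lam + t`. -/
theorem designMatrix_bounds {n : Type*} [Fintype n] [DecidableEq n] {T : ℕ} {lam : ℝ}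
    (hlam : 1 ≤ lam) {A : ℕ → Matrix n n ℝ} {z : ℕ → n → ℝ}
    (hA0 : A 0 = lam • (1 : Matrix n n ℝ))
    (hArec : ∀ t < T, A (t + 1) = A t + vecMulVec (z t) (z t))
    (hz : ∀ t < T, z t ⬝ᵥ z t ≤ 1) (t : ℕ) (ht : t ≤ T) :
    (A t).PosDef ∧ (∀ v, v ⬝ᵥ v ≤ v ⬝ᵥ A t *ᵥ v) ∧
      ∀ v, v ⬝ᵥ A t *ᵥ v ≤ (lam + t) * (v ⬝ᵥ v) := by
  have hvv (v : n → ℝ) : 0 ≤ v ⬝ᵥ v := by simpa using dotProduct_star_self_nonneg v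
  induction t with
  | zero =>
    rw [hA0]
    refine ⟨PosDef.one.smul (by linarith), fun v => ?_, fun v => ?_⟩
    · simp only [smul_mulVec, one_mulVec, dotProduct_smul, smul_eq_mul]
      nlinarith [hvv v]
    · simp [smul_mulVec]
  | succ t ih =>
    obtain ⟨hp, hl, hu⟩ := ih (by omega)
    rw [hArec t ht]
    refine ⟨hp.add_vecMulVec_self _, fun v => ?_, fun v => ?_⟩ <;>
      rw [add_mulVec, dotProduct_add, dotProduct_vecMulVec_self_mulVec]
    · nlinarith [hl v, sq_nonneg (z t ⬝ᵥ v)]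
    · push_cast
      have h := sq_dotProduct_le (z t) v
      nlinarith [hu v, mul_le_mul_of_nonneg_right (hz t ht) (hvv v)]

/-- The elliptical potential lemma. -/
theorem sum_dotProduct_inv_mulVec_le {n : Type*} [Fintype n] [DecidableEq n] {T : ℕ} {lam : ℝ}
    (hlam : 1 ≤ lam) {A : ℕ → Matrix n n ℝ} {z : ℕ → n → ℝ}
    (hA0 : A 0 = lam • (1 : Matrix n n ℝ))
    (hArec : ∀ t < T, A (t + 1) = A t + vecMulVec (z t) (z t))
    (hz : ∀ t < T, z t ⬝ᵥ z t ≤ 1) :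
    ∑ t ∈ Finset.range T, z t ⬝ᵥ (A t)⁻¹ *ᵥ z t ≤
      2 * (Fintype.card n * Real.log (1 + T / lam)) := by
  have hb := designMatrix_bounds hlam hA0 hArec hz
  have hw0 (t : ℕ) (ht : t < T) : 0 ≤ z t ⬝ᵥ (A t)⁻¹ *ᵥ z t := by
    simpa using (hb t ht.le).1.inv.posSemidef.dotProduct_mulVec_nonneg (z t)
  have hsum : ∑ t ∈ Finset.range T, Real.log (1 + z t ⬝ᵥ (A t)⁻¹ *ᵥ z t) =
      Real.log (A T).det - Real.log (A 0).det := by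
    rw [← Finset.sum_range_sub (fun t => Real.log (A t).det)]
    refine Finset.sum_congr rfl fun t ht => ?_
    have ht := Finset.mem_range.mp ht
    rw [hArec t ht, (hb t ht.le).1.det_add_vecMulVec,
      Real.log_mul (hb t ht.le).1.det_pos.ne' (by linarith [hw0 t ht])]
    ring
  have hdet : Real.log (A T).det ≤ Fintype.card n * Real.log (lam + T) := by
    rw [← Real.log_pow]
    exact Real.log_le_log (hb T le_rfl).1.det_pos
      ((hb T le_rfl).1.det_le_pow (hb T le_rfl).2.2)
  have hdet0 : Real.log (A 0).det = Fintype.card n * Real.log lam := by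
    rw [hA0, det_smul, det_one, mul_one, Real.log_pow]
  have hlog : Real.log (1 + T / lam) = Real.log (lam + T) - Real.log lam := by
    rw [← Real.log_div (by positivity) (by positivity)]
    congr 1
    field_simp
  calc ∑ t ∈ Finset.range T, z t ⬝ᵥ (A t)⁻¹ *ᵥ z t
      ≤ ∑ t ∈ Finset.range T, 2 * Real.log (1 + z t ⬝ᵥ (A t)⁻¹ *ᵥ z t) := by
        refine Finset.sum_le_sum fun t ht => ?_
        have ht := Finset.mem_range.mp ht
        exact Real.le_two_mul_log_one_add (hw0 t ht)
          ((hb t ht.le).1.dotProduct_inv_mulVec_le_one (hb t ht.le).2.1 (hz t ht))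
    _ ≤ 2 * (Fintype.card n * Real.log (1 + T / lam)) := by
        rw [← Finset.mul_sum, hsum, hlog, hdet0, mul_sub]
        linarith

/-- Near-oracle cumulative task quality (Corollary 1, deterministic core): with ridge design matrices `A_0 = λ I`,
`A_t = A_{t−1} + x_{a_t,t} x_{a_t,t}ᵀ` (λ ≥ 1), bounded contexts, UCB-optimal
selections `a_t`, optimal candidate arms `j_t* ∈ C_t`, nondecreasing
nonnegative exploration coefficients `β_0 ≤ … ≤ β_T`, and the confidence
condition `‖θ̂_{t−1} − θ*‖_{A_{t−1}} ≤ β_{t−1}` for all rounds, the cumulative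
reward satisfies `ALG(T) ≥ OPT(T) − 2 β_T √(2 T d log(1 + T/λ))`. -/
theorem linucb_near_oracle_quality
    {d : ℕ} {ι : Type*} (T : ℕ) (lam : ℝ) (hlam : 1 ≤ lam)
    (β : ℕ → ℝ)
    (hβ0 : ∀ t ≤ T, 0 ≤ β t)
    (hβmono : ∀ s t : ℕ, s ≤ t → t ≤ T → β s ≤ β t)
    (C : ℕ → Finset ι)
    (hC : ∀ t, 1 ≤ t → t ≤ T → (C t).Nonempty)
    (x : ℕ → ι → Fin d → ℝ)
    (hx : ∀ t, 1 ≤ t → t ≤ T → ∀ j ∈ C t, Real.sqrt (x t j ⬝ᵥ x t j) ≤ 1)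
    (θstar : Fin d → ℝ)
    (μ : ℕ → ι → ℝ)
    (hμ : ∀ t, 1 ≤ t → t ≤ T → ∀ j ∈ C t, μ t j = x t j ⬝ᵥ θstar)
    (θhat : ℕ → Fin d → ℝ)
    (a : ℕ → ι)
    (A : ℕ → Matrix (Fin d) (Fin d) ℝ)
    (hA0 : A 0 = lam • (1 : Matrix (Fin d) (Fin d) ℝ))
    (hArec : ∀ t, 1 ≤ t → t ≤ T →
      A t = A (t - 1) + vecMulVec (x t (a t)) (x t (a t)))
    (ha : ∀ t, 1 ≤ t → t ≤ T → a t ∈ C t)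
    (hamax : ∀ t, 1 ≤ t → t ≤ T → ∀ j ∈ C t,
      x t j ⬝ᵥ θhat (t - 1) +
          β (t - 1) * Real.sqrt (x t j ⬝ᵥ (A (t - 1))⁻¹ *ᵥ x t j) ≤
        x t (a t) ⬝ᵥ θhat (t - 1) +
          β (t - 1) * Real.sqrt (x t (a t) ⬝ᵥ (A (t - 1))⁻¹ *ᵥ x t (a t)))
    (jstar : ℕ → ι)
    (hjstar : ∀ t, 1 ≤ t → t ≤ T → jstar t ∈ C t)
    (hjmax : ∀ t, 1 ≤ t → t ≤ T → ∀ j ∈ C t, μ t j ≤ μ t (jstar t))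
    (hconf : ∀ t, 1 ≤ t → t ≤ T →
      Real.sqrt ((θhat (t - 1) - θstar) ⬝ᵥ
          A (t - 1) *ᵥ (θhat (t - 1) - θstar)) ≤ β (t - 1)) :
    ∑ t ∈ Finset.Icc 1 T, μ t (a t) ≥
      (∑ t ∈ Finset.Icc 1 T, μ t (jstar t)) -
        2 * β T * Real.sqrt (2 * T * d * Real.log (1 + T / lam)) := by
  have hsum (f : ℕ → ℝ) : ∑ t ∈ Finset.Icc 1 T, f t = ∑ t ∈ Finset.range T, f (t + 1) := by
    rw [Finset.range_eq_Ico, Finset.sum_Ico_add' f 0 T 1]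
    rfl
  have hrec : ∀ t < T, A (t + 1) =
      A t + vecMulVec (x (t + 1) (a (t + 1))) (x (t + 1) (a (t + 1))) := fun t ht =>
    hArec (t + 1) (by omega) ht
  have hz : ∀ t < T, x (t + 1) (a (t + 1)) ⬝ᵥ x (t + 1) (a (t + 1)) ≤ 1 := fun t ht =>
    Real.sqrt_le_one.mp (hx (t + 1) (by omega) ht _ (ha (t + 1) (by omega) ht))
  have hb := designMatrix_bounds hlam hA0 hrec hz
  have hpot := sum_dotProduct_inv_mulVec_le hlam hA0 hrec hz
  rw [Fintype.card_fin] at hpot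
  set q : ℕ → ℝ := fun t => x (t + 1) (a (t + 1)) ⬝ᵥ (A t)⁻¹ *ᵥ x (t + 1) (a (t + 1)) with hq
  have hq0 (t : ℕ) (ht : t < T) : 0 ≤ q t := by
    simpa using (hb t ht.le).1.inv.posSemidef.dotProduct_mulVec_nonneg (x (t + 1) (a (t + 1)))
  have hround (t : ℕ) (ht : t < T) :
      μ (t + 1) (jstar (t + 1)) - μ (t + 1) (a (t + 1)) ≤ 2 * β T * √(q t) := by
    have h1 : 1 ≤ t + 1 := by omega
    have hdev (j : ι) : |x (t + 1) j ⬝ᵥ θhat t - x (t + 1) j ⬝ᵥ θstar| ≤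
        β t * √(x (t + 1) j ⬝ᵥ (A t)⁻¹ *ᵥ x (t + 1) j) := by
      rw [← dotProduct_sub, mul_comm]
      exact ((hb t ht.le).1.abs_dotProduct_le _ _).trans
        (mul_le_mul_of_nonneg_left (hconf (t + 1) h1 ht) (Real.sqrt_nonneg _))
    have hj := abs_le.mp (hdev (jstar (t + 1)))
    have hat := abs_le.mp (hdev (a (t + 1)))
    have hm := hamax (t + 1) h1 ht _ (hjstar (t + 1) h1 ht)
    simp only [Nat.add_sub_cancel] at hm
    rw [hμ (t + 1) h1 ht _ (hjstar (t + 1) h1 ht), hμ (t + 1) h1 ht _ (ha (t + 1) h1 ht)]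
    have hβ := mul_le_mul_of_nonneg_right (hβmono t T ht.le le_rfl) (Real.sqrt_nonneg (q t))
    simp only [hq] at hβ ⊢
    linarith [hj.1, hat.2]
  have hcs : ∑ t ∈ Finset.range T, √(q t) ≤ √(2 * T * d * Real.log (1 + T / lam)) := by
    refine Real.le_sqrt_of_sq_le (sq_sum_le_card_mul_sum_sq.trans ?_)
    rw [Finset.card_range, Finset.sum_congr rfl fun t ht =>
      Real.sq_sqrt (hq0 t (Finset.mem_range.mp ht))]
    calc (T : ℝ) * ∑ t ∈ Finset.range T, q t
        ≤ T * (2 * (d * Real.log (1 + T / lam))) :=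
          mul_le_mul_of_nonneg_left hpot (Nat.cast_nonneg T)
      _ = 2 * T * d * Real.log (1 + T / lam) := by ring
  have hreg := Finset.sum_le_sum fun t ht => hround t (Finset.mem_range.mp ht)
  rw [Finset.sum_sub_distrib, ← Finset.mul_sum] at hreg
  have hβT : 0 ≤ 2 * β T := mul_nonneg zero_le_two (hβ0 T le_rfl)
  rw [hsum, hsum]
  linarith [mul_le_mul_of_nonneg_left hcs hβT]
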